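/- (Generalization bound for functional-response ridge regression.) Assume ‖y‖_Y ≤ C_y for P-almost every (x,y) ∈ X×Y. Assume that for every n and every sample z ∈ (X×Y)^n whose outputs have norm at most C_y there is a unique global minimizer f_z ∈ H of f ↦ (1/n)∑_{k=1}^n ‖y_k − ev x_k f‖_Y² + λ‖f‖_H², and that the resulting maps z ↦ f_z and ((x,y), z) ↦ ‖y − ev x f_z‖_Y² are measurable. Then for every m ≥ 1 and 0 < δ ≤ 1, with probability at least 1 − δ over a sample z drawn from P^{⊗m}: ∫ ‖y − ev x f_z‖_Y² dP(x,y) ≤ (1/m)∑_{k=1}^m ‖y_k − ev x_k f_z‖_Y² + (1/m)·4 C_y² κ² (1 + κ/√λ)²/λ + (1/√m)·C_y² (1 + κ/√λ)² (8κ²/λ + 1)·√(ln(1/δ)/2). -/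

import Mathlib

open MeasureTheory
open scoped InnerProductSpace

section Concentration

open ProbabilityTheory
open scoped NNReal

variable {Ω : Type*} [MeasurableSpace Ω] (P : Measure Ω) [IsProbabilityMeasure P]

/-- Resampling one coordinate of an i.i.d. sample does not change its law. -/
lemma measurePreserving_update_pi {n : ℕ} (k : Fin n) :
    MeasurePreserving (fun q : Ω × (Fin n → Ω) => Function.update q.2 k q.1)
      (P.prod (Measure.pi fun _ : Fin n => P)) (Measure.pi fun _ : Fin n => P) := by
  have hmeas : Measurable (fun q : Ω × (Fin n → Ω) => Function.update q.2 k q.1) :=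
    measurable_update'.comp measurable_swap
  refine ⟨hmeas, (Measure.pi_eq fun s hs => ?_).symm⟩
  have hpre : (fun q : Ω × (Fin n → Ω) => Function.update q.2 k q.1) ⁻¹' Set.univ.pi s =
      s k ×ˢ Set.univ.pi (Function.update s k Set.univ) := by
    ext ⟨w, z⟩
    simp only [Set.mem_preimage, Set.mem_univ_pi, Set.mem_prod]
    constructor
    · intro h
      refine ⟨by simpa using h k, fun j => ?_⟩
      rcases eq_or_ne j k with rfl | hj
      · simp
      · simpa [hj] using h j
    · rintro ⟨hw, h⟩ j
      rcases eq_or_ne j k with rfl | hj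
      · simpa using hw
      · simpa [hj] using h j
  rw [Measure.map_apply hmeas (MeasurableSet.univ_pi hs), hpre, Measure.prod_prod,
    Measure.pi_pi, ← Finset.mul_prod_erase _ _ (Finset.mem_univ k),
    ← Finset.mul_prod_erase _ (fun i => P (s i)) (Finset.mem_univ k)]
  simp only [Function.update_self, measure_univ, one_mul]
  congr 1
  refine Finset.prod_congr rfl fun j hj => ?_
  rw [Function.update_of_ne (Finset.ne_of_mem_erase hj)]

lemma Measurable.integrable_of_abs_le {α : Type*} [MeasurableSpace α] {μ : Measure α}
    [IsFiniteMeasure μ] {f : α → ℝ} (hf : Measurable f) {B : ℝ} (hB : ∀ x, |f x| ≤ B) :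
    Integrable f μ :=
  Integrable.of_bound hf.aestronglyMeasurable B (.of_forall hB)

lemma abs_integral_le_of_abs_le {α : Type*} [MeasurableSpace α] {μ : Measure α}
    [IsProbabilityMeasure μ] {f : α → ℝ} {B : ℝ} (hB : ∀ x, |f x| ≤ B) :
    |∫ x, f x ∂μ| ≤ B := by
  simpa using norm_integral_le_of_norm_le_const (μ := μ) (f := f) (.of_forall hB)

/-- **Hoeffding's lemma** for a bounded function of oscillation at most `c`. -/
lemma hasSubgaussianMGF_of_abs_sub_le {g : Ω → ℝ} (hg : Measurable g) {c : ℝ≥0}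
    (hc : ∀ w w', |g w - g w'| ≤ c) :
    HasSubgaussianMGF (fun w => g w - ∫ w', g w' ∂P) ((c / 2) ^ 2) P := by
  have : Nonempty Ω := P.nonempty_of_neZero
  have hbdd : BddBelow (Set.range g) := by
    refine ⟨g (Classical.arbitrary Ω) - c, ?_⟩
    rintro _ ⟨w, rfl⟩
    linarith [(abs_le.1 (hc w (Classical.arbitrary Ω))).1]
  have h := hasSubgaussianMGF_of_mem_Icc (μ := P) (X := g) (a := ⨅ w, g w)
    (b := (⨅ w, g w) + c) hg.aemeasurable (.of_forall fun w => ⟨ciInf_le hbdd w, ?_⟩)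
  · simpa using h
  · have : g w - c ≤ ⨅ w', g w' := le_ciInf fun w' => by linarith [(abs_le.1 (hc w w')).2]
    linarith

/-- **McDiarmid's inequality**, in moment generating function form: a bounded function of an
i.i.d. sample with bounded differences is sub-Gaussian after centering. -/
theorem hasSubgaussianMGF_of_bounded_differences {n : ℕ} {f : (Fin n → Ω) → ℝ}
    (hf : Measurable f) {B : ℝ} (hB : ∀ z, |f z| ≤ B) (c : Fin n → ℝ≥0)
    (hc : ∀ z i w, |f z - f (Function.update z i w)| ≤ c i) :
    HasSubgaussianMGF (fun z => f z - ∫ z', f z' ∂(Measure.pi fun _ : Fin n => P))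
      (∑ i, (c i / 2) ^ 2) (Measure.pi fun _ : Fin n => P) := by
  have hint : ∀ t : ℝ, Integrable (fun z => Real.exp
      (t * (f z - ∫ z', f z' ∂(Measure.pi fun _ : Fin n => P))))
      (Measure.pi fun _ : Fin n => P) := by
    intro t
    refine Measurable.integrable_of_abs_le (by fun_prop) (B := Real.exp (|t| * (B + B))) fun z => ?_
    rw [Real.abs_exp, Real.exp_le_exp]
    refine (le_abs_self _).trans ?_
    rw [abs_mul]
    gcongr
    exact (abs_sub _ _).trans (add_le_add (hB z) (abs_integral_le_of_abs_le hB))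
  induction n with
  | zero =>
    refine ⟨hint, fun t => ?_⟩
    have hconst : ∀ z z' : Fin 0 → Ω, f z = f z' := fun z z' => by rw [Subsingleton.elim z z']
    have : ∀ z, f z - ∫ z', f z' ∂(Measure.pi fun _ : Fin 0 => P) = 0 := fun z => by
      simp [fun z' => hconst z' z]
    simp [mgf, this]
  | succ n ih =>
    refine ⟨hint, fun t => ?_⟩
    set μ := Measure.pi fun _ : Fin n => P with hμ
    have hmp : MeasurePreserving (fun q : Ω × (Fin n → Ω) => (Fin.cons q.1 q.2 : Fin (n + 1) → Ω))
        (P.prod μ) (Measure.pi fun _ : Fin (n + 1) => P) := by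
      have := (measurePreserving_piFinSuccAbove (fun _ : Fin (n + 1) => P) 0).symm
      simpa [MeasurableEquiv.piFinSuccAbove, Fin.insertNthEquiv, Fin.insertNth_zero] using! this
    have htrans : ∀ h : (Fin (n + 1) → Ω) → ℝ, Measurable h →
        Integrable h (Measure.pi fun _ : Fin (n + 1) => P) →
        ∫ z, h z ∂(Measure.pi fun _ : Fin (n + 1) => P) =
          ∫ w, ∫ z, h (Fin.cons w z) ∂μ ∂P := by
      intro h hh hi
      rw [← hmp.map_eq, integral_map hmp.aemeasurable hh.aestronglyMeasurable, integral_prod]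
      exact (hmp.integrable_comp hh.aestronglyMeasurable).2 hi
    set g : Ω → ℝ := fun w => ∫ z, f (Fin.cons w z) ∂μ with hgdef
    have hfc : Measurable fun q : Ω × (Fin n → Ω) => f (Fin.cons q.1 q.2) :=
      hf.comp hmp.measurable
    have hfw : ∀ w, Measurable fun z : Fin n → Ω => f (Fin.cons w z) :=
      fun w => hfc.comp measurable_prodMk_left
    have hg : Measurable g := hfc.stronglyMeasurable.integral_prod_right'.measurable
    have hEf : ∫ z, f z ∂(Measure.pi fun _ : Fin (n + 1) => P) = ∫ w, g w ∂P :=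
      htrans f hf (hf.integrable_of_abs_le hB)
    have hgc : ∀ w w', |g w - g w'| ≤ c 0 := by
      intro w w'
      rw [hgdef]
      dsimp only
      rw [← integral_sub ((hfw w).integrable_of_abs_le fun _ => hB _)
        ((hfw w').integrable_of_abs_le fun _ => hB _)]
      refine abs_integral_le_of_abs_le fun z => ?_
      simpa [Fin.update_cons_zero] using hc (Fin.cons w z) 0 w'
    have hgsub := hasSubgaussianMGF_of_abs_sub_le P hg hgc
    have hinner : ∀ w, HasSubgaussianMGF (fun z => f (Fin.cons w z) - g w)
        (∑ i : Fin n, (c i.succ / 2) ^ 2) μ := by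
      intro w
      have hcw : ∀ z i w', |f (Fin.cons w z) - f (Fin.cons w (Function.update z i w'))|
          ≤ c i.succ := fun z i w' => by
        simpa [Fin.cons_update] using hc (Fin.cons w z) i.succ w'
      refine ih (hfw w) (fun _ => hB _) (fun i => c i.succ) hcw fun t => ?_
      refine Measurable.integrable_of_abs_le (((hfw w).sub_const _).const_mul t).exp
        (B := Real.exp (|t| * (B + B))) fun z => ?_
      rw [Real.abs_exp, Real.exp_le_exp]
      refine (le_abs_self _).trans ?_
      rw [abs_mul]
      gcongr
      exact (abs_sub _ _).trans (add_le_add (hB _) (abs_integral_le_of_abs_le fun _ => hB _))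
    rw [mgf, htrans _ (by fun_prop) (hint t), hEf]
    calc ∫ w, ∫ z, Real.exp (t * (f (Fin.cons w z) - ∫ w, g w ∂P)) ∂μ ∂P
        = ∫ w, Real.exp (t * (g w - ∫ w, g w ∂P)) *
            mgf (fun z => f (Fin.cons w z) - g w) μ t ∂P := by
          refine integral_congr_ae (.of_forall fun w => ?_)
          dsimp only [mgf]
          rw [← integral_const_mul]
          refine integral_congr_ae (.of_forall fun z => ?_)
          dsimp only
          rw [← Real.exp_add]
          congr 1
          ring
      _ ≤ ∫ w, Real.exp (t * (g w - ∫ w, g w ∂P)) *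
            Real.exp ((∑ i : Fin n, (c i.succ / 2) ^ 2 : ℝ≥0) * t ^ 2 / 2) ∂P := by
          refine integral_mono_of_nonneg (.of_forall fun w => ?_)
            ((hgsub.integrable_exp_mul t).mul_const _) (.of_forall fun w => ?_)
          · exact mul_nonneg (Real.exp_nonneg _) mgf_nonneg
          · exact mul_le_mul_of_nonneg_left ((hinner w).mgf_le t) (Real.exp_nonneg _)
      _ = mgf (fun w => g w - ∫ w', g w' ∂P) P t *
            Real.exp ((∑ i : Fin n, (c i.succ / 2) ^ 2 : ℝ≥0) * t ^ 2 / 2) := by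
          rw [integral_mul_const, mgf]
      _ ≤ Real.exp (((c 0 / 2) ^ 2 : ℝ≥0) * t ^ 2 / 2) *
            Real.exp ((∑ i : Fin n, (c i.succ / 2) ^ 2 : ℝ≥0) * t ^ 2 / 2) :=
          mul_le_mul_of_nonneg_right (hgsub.mgf_le t) (Real.exp_nonneg _)
      _ = Real.exp ((∑ i, (c i / 2) ^ 2 : ℝ≥0) * t ^ 2 / 2) := by
          rw [← Real.exp_add, Fin.sum_univ_succ]
          push_cast
          congr 1
          ring

/-- **McDiarmid's inequality** as a confidence bound, with equal difference bounds `c`. -/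
theorem one_sub_le_measure_of_bounded_differences {n : ℕ} (hn : 0 < n) {f : (Fin n → Ω) → ℝ}
    (hf : Measurable f) {B : ℝ} (hB : ∀ z, |f z| ≤ B) {c : ℝ} (hc0 : 0 < c)
    (hc : ∀ z i w, |f z - f (Function.update z i w)| ≤ c) {δ : ℝ} (hδ0 : 0 < δ) (hδ1 : δ ≤ 1) :
    ENNReal.ofReal (1 - δ) ≤ (Measure.pi fun _ : Fin n => P)
      {z | f z ≤ ∫ z', f z' ∂(Measure.pi fun _ : Fin n => P) +
        c * Real.sqrt n * Real.sqrt (Real.log (1 / δ) / 2)} := by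
  lift c to ℝ≥0 using hc0.le
  set μ := Measure.pi fun _ : Fin n => P
  set ε := c * Real.sqrt n * Real.sqrt (Real.log (1 / δ) / 2) with hεdef
  have hε : 0 ≤ ε := by positivity
  have hlog : 0 ≤ Real.log (1 / δ) := Real.log_nonneg (by rw [le_div_iff₀ hδ0]; linarith)
  have hnR : (0 : ℝ) < n := by exact_mod_cast hn
  have hsub := hasSubgaussianMGF_of_bounded_differences P hf hB (fun _ => c) hc
  have htail : μ.real {z | ε ≤ f z - ∫ z', f z' ∂μ} ≤ δ := by
    refine (hsub.measure_ge_le hε).trans (le_of_eq ?_)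
    have hexp : -ε ^ 2 / (2 * ((∑ _i : Fin n, (c / 2) ^ 2 : ℝ≥0) : ℝ)) =
        Real.log δ := by
      have : ε ^ 2 = c ^ 2 * n * (Real.log (1 / δ) / 2) := by
        rw [hεdef, mul_pow, mul_pow, Real.sq_sqrt hnR.le, Real.sq_sqrt (by positivity)]
      rw [this]
      simp only [Finset.sum_const, Finset.card_univ, Fintype.card_fin, NNReal.coe_mul,
        NNReal.coe_natCast, NNReal.coe_pow, NNReal.coe_div, NNReal.coe_ofNat, nsmul_eq_mul, one_div, Real.log_inv]
      field_simp
    rw [hexp, Real.exp_log hδ0]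
  have hmeas : MeasurableSet {z | ε ≤ f z - ∫ z', f z' ∂μ} :=
    measurableSet_le measurable_const (hf.sub_const _)
  rw [← ofReal_measureReal]
  refine ENNReal.ofReal_le_ofReal ?_
  calc 1 - δ ≤ 1 - μ.real {z | ε ≤ f z - ∫ z', f z' ∂μ} := by linarith
    _ = μ.real {z | ε ≤ f z - ∫ z', f z' ∂μ}ᶜ := (probReal_compl_eq_one_sub hmeas).symm
    _ ≤ _ := by
      refine measureReal_mono fun z hz => ?_
      simp only [Set.mem_compl_iff, Set.mem_ofPred_eq, not_le] at hz ⊢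
      linarith

/-- Generalization bound for a uniformly stable learning rule with bounded loss: `L (p, z)` is the
loss at the test point `p` of the hypothesis learned from the sample `z`. -/
theorem one_sub_le_measure_of_uniform_stability {n : ℕ} (hn : 0 < n)
    {L : Ω × (Fin n → Ω) → ℝ} (hL : Measurable L) {M b : ℝ} (hM : 0 < M) (hb0 : 0 ≤ b)
    (hL0 : ∀ q, 0 ≤ L q) (hLM : ∀ q, L q ≤ M)
    (hb : ∀ p z i w, |L (p, z) - L (p, Function.update z i w)| ≤ b)
    {δ : ℝ} (hδ0 : 0 < δ) (hδ1 : δ ≤ 1) :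
    ENNReal.ofReal (1 - δ) ≤ (Measure.pi fun _ : Fin n => P)
      {z | ∫ p, L (p, z) ∂P ≤ (1 / (n : ℝ)) * ∑ k, L (z k, z) + b +
        (2 * b + M / n) * Real.sqrt n * Real.sqrt (Real.log (1 / δ) / 2)} := by
  set μ := Measure.pi fun _ : Fin n => P with hμ
  have hnR : (0 : ℝ) < n := by exact_mod_cast hn
  have hLabs : ∀ q, |L q| ≤ M := fun q => by rw [abs_of_nonneg (hL0 q)]; exact hLM q
  have hLp : ∀ z, Measurable fun p => L (p, z) := fun z => hL.comp measurable_prodMk_right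
  have hLk : ∀ k, Measurable fun z : Fin n → Ω => L (z k, z) := fun k =>
    hL.comp ((measurable_pi_apply k).prodMk measurable_id)
  have hR : Measurable fun z => ∫ p, L (p, z) ∂P :=
    hL.stronglyMeasurable.integral_prod_left'.measurable
  have hRabs : ∀ z, |∫ p, L (p, z) ∂P| ≤ M := fun z => abs_integral_le_of_abs_le fun _ => hLabs _
  set Φ : (Fin n → Ω) → ℝ := fun z => ∫ p, L (p, z) ∂P - (1 / (n : ℝ)) * ∑ k, L (z k, z) with hΦ
  have hΦm : Measurable Φ :=
    hR.sub ((Finset.measurable_fun_sum _ fun k _ => hLk k).const_mul _)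
  have hΦB : ∀ z, |Φ z| ≤ M + 1 / (n : ℝ) * ∑ _k : Fin n, M := fun z => by
    refine (abs_sub _ _).trans (add_le_add (hRabs z) ?_)
    rw [abs_mul, abs_of_nonneg (by positivity : (0 : ℝ) ≤ 1 / n)]
    gcongr
    exact (Finset.abs_sum_le_sum_abs _ _).trans (Finset.sum_le_sum fun k _ => hLabs _)
  have hΦc : ∀ z i w, |Φ z - Φ (Function.update z i w)| ≤ 2 * b + M / n := by
    intro z i w
    set z' := Function.update z i w with hz'
    have h1 : |∫ p, L (p, z) ∂P - ∫ p, L (p, z') ∂P| ≤ b := by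
      rw [← integral_sub ((hLp z).integrable_of_abs_le fun _ => hLabs _)
        ((hLp z').integrable_of_abs_le fun _ => hLabs _)]
      exact abs_integral_le_of_abs_le fun p => hb p z i w
    have h2 : |∑ k, L (z k, z) - ∑ k, L (z' k, z')| ≤ n * b + M := by
      rw [← Finset.sum_sub_distrib]
      refine (Finset.abs_sum_le_sum_abs _ _).trans ?_
      calc ∑ k, |L (z k, z) - L (z' k, z')| ≤ ∑ k, (b + if k = i then M else 0) := by
            refine Finset.sum_le_sum fun k _ => ?_
            rcases eq_or_ne k i with rfl | hk
            · rw [if_pos rfl, abs_le]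
              constructor <;> linarith [hL0 (z k, z), hLM (z k, z), hL0 (z' k, z'), hLM (z' k, z')]
            · simpa [hk, hz'] using hb (z k) z i w
        _ = n * b + M := by simp [Finset.sum_add_distrib]
    have h3 : Φ z - Φ z' = (∫ p, L (p, z) ∂P - ∫ p, L (p, z') ∂P) -
        1 / n * (∑ k, L (z k, z) - ∑ k, L (z' k, z')) := by
      rw [hΦ]; ring
    rw [h3]
    refine (abs_sub _ _).trans ?_
    rw [abs_mul, abs_of_nonneg (by positivity : (0 : ℝ) ≤ 1 / n)]
    calc _ ≤ b + 1 / n * (n * b + M) := by gcongr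
      _ = 2 * b + M / n := by field_simp; ring
  have hΦE : ∫ z, Φ z ∂μ ≤ b := by
    have hk : ∀ k, ∫ z, ∫ p, L (p, z) ∂P ∂μ - b ≤ ∫ z, L (z k, z) ∂μ := by
      intro k
      have hmp := measurePreserving_update_pi P k
      have hmeas : Measurable fun q : Ω × (Fin n → Ω) => L (q.1, Function.update q.2 k q.1) :=
        hL.comp (measurable_fst.prodMk hmp.measurable)
      have hLint : Integrable L (P.prod μ) := hL.integrable_of_abs_le hLabs
      calc ∫ z, ∫ p, L (p, z) ∂P ∂μ - b = ∫ q, (L q - b) ∂(P.prod μ) := by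
            rw [integral_sub hLint (integrable_const _), integral_prod_symm _ hLint]
            simp
        _ ≤ ∫ q, L (q.1, Function.update q.2 k q.1) ∂(P.prod μ) := by
            refine integral_mono (hLint.sub (integrable_const _))
              (hmeas.integrable_of_abs_le fun _ => hLabs _) fun q => ?_
            linarith [(abs_le.1 (hb q.1 q.2 k q.1)).2]
        _ = ∫ z, L (z k, z) ∂μ := by
            conv_rhs => rw [hμ, ← hmp.map_eq]
            rw [integral_map hmp.aemeasurable (hLk k).aestronglyMeasurable]
            simp [hμ]
    rw [hΦ, integral_sub (hR.integrable_of_abs_le hRabs)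
      ((integrable_finsetSum _ fun k _ => (hLk k).integrable_of_abs_le fun _ => hLabs _).const_mul
        _), integral_const_mul, integral_finsetSum _ fun k _ =>
        (hLk k).integrable_of_abs_le fun _ => hLabs _]
    have hsum := Finset.sum_le_sum fun k (_ : k ∈ Finset.univ) => hk k
    rw [Finset.sum_const, Finset.card_univ, Fintype.card_fin, nsmul_eq_mul] at hsum
    have := mul_le_mul_of_nonneg_left hsum (by positivity : (0 : ℝ) ≤ 1 / n)
    rw [← mul_assoc, one_div_mul_cancel hnR.ne', one_mul] at this
    linarith
  refine (one_sub_le_measure_of_bounded_differences P hn hΦm hΦB (c := 2 * b + M / n)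
    (by positivity) hΦc hδ0 hδ1).trans (measure_mono fun z hz => ?_)
  simp only [Set.mem_ofPred_eq, hΦ] at hz ⊢
  linarith

end Concentration

section Ridge

variable {X Y H : Type*} [NormedAddCommGroup Y] [InnerProductSpace ℝ Y]
  [NormedAddCommGroup H] [InnerProductSpace ℝ H]

/-- The regularized empirical risk minimized by functional-response ridge regression. -/
noncomputable def ridgeObjective (ev : X → (H →L[ℝ] Y)) (lam : ℝ) {n : ℕ} (z : Fin n → X × Y)
    (f : H) : ℝ :=
  (1 / (n : ℝ)) * ∑ k, ‖(z k).2 - ev (z k).1 f‖ ^ 2 + lam * ‖f‖ ^ 2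

lemma norm_sq_convex_combination {E : Type*} [NormedAddCommGroup E] [InnerProductSpace ℝ E]
    (u v : E) (t : ℝ) :
    ‖(1 - t) • u + t • v‖ ^ 2 =
      (1 - t) * ‖u‖ ^ 2 + t * ‖v‖ ^ 2 - t * (1 - t) * ‖v - u‖ ^ 2 := by
  rw [norm_add_sq_real, norm_sub_sq_real, norm_smul, norm_smul, real_inner_smul_left,
    real_inner_smul_right, mul_pow, mul_pow, Real.norm_eq_abs, Real.norm_eq_abs, sq_abs, sq_abs,
    real_inner_comm u v]
  ring

lemma ridgeObjective_convex_combination_le (ev : X → (H →L[ℝ] Y)) (lam : ℝ) {n : ℕ}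
    (z : Fin n → X × Y) (f g : H) {t : ℝ} (ht0 : 0 ≤ t) (ht1 : t ≤ 1) :
    ridgeObjective ev lam z ((1 - t) • f + t • g) ≤
      (1 - t) * ridgeObjective ev lam z f + t * ridgeObjective ev lam z g -
        t * (1 - t) * (lam * ‖g - f‖ ^ 2) := by
  have hk : ∀ k, ‖(z k).2 - ev (z k).1 ((1 - t) • f + t • g)‖ ^ 2 ≤
      (1 - t) * ‖(z k).2 - ev (z k).1 f‖ ^ 2 + t * ‖(z k).2 - ev (z k).1 g‖ ^ 2 := fun k => by
    have : (z k).2 - ev (z k).1 ((1 - t) • f + t • g) =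
        (1 - t) • ((z k).2 - ev (z k).1 f) + t • ((z k).2 - ev (z k).1 g) := by
      rw [map_add, map_smul, map_smul]
      module
    rw [this, norm_sq_convex_combination]
    have := mul_nonneg (mul_nonneg ht0 (sub_nonneg.2 ht1))
      (sq_nonneg ‖((z k).2 - ev (z k).1 g) - ((z k).2 - ev (z k).1 f)‖)
    linarith
  have hsum := Finset.sum_le_sum fun k (_ : k ∈ Finset.univ) => hk k
  rw [Finset.sum_add_distrib, ← Finset.mul_sum, ← Finset.mul_sum] at hsum
  have := mul_le_mul_of_nonneg_left hsum (by positivity : (0 : ℝ) ≤ 1 / n)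
  unfold ridgeObjective
  rw [norm_sq_convex_combination f g]
  linarith

/-- Strong convexity at the minimizer of the ridge objective. -/
lemma mul_norm_sub_sq_le_ridgeObjective_sub (ev : X → (H →L[ℝ] Y)) {lam : ℝ} {n : ℕ}
    {z : Fin n → X × Y} {f : H} (hf : ∀ g, ridgeObjective ev lam z f ≤ ridgeObjective ev lam z g)
    (g : H) :
    lam * ‖g - f‖ ^ 2 ≤ ridgeObjective ev lam z g - ridgeObjective ev lam z f := by
  have hlim : Filter.Tendsto (fun t : ℝ => (1 - t) * (lam * ‖g - f‖ ^ 2))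
      (nhdsWithin 0 (Set.Ioi 0)) (nhds (lam * ‖g - f‖ ^ 2)) := by
    have : Continuous fun t : ℝ => (1 - t) * (lam * ‖g - f‖ ^ 2) := by fun_prop
    simpa using (this.tendsto 0).mono_left nhdsWithin_le_nhds
  refine le_of_tendsto hlim ?_
  filter_upwards [Ioo_mem_nhdsGT one_pos] with t ht
  have h := (hf _).trans (ridgeObjective_convex_combination_le ev lam z f g ht.1.le ht.2.le)
  have : t * ((1 - t) * (lam * ‖g - f‖ ^ 2)) ≤
      t * (ridgeObjective ev lam z g - ridgeObjective ev lam z f) := by linarith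
  exact le_of_mul_le_mul_left this ht.1

variable {ev : X → (H →L[ℝ] Y)} {κ lam C : ℝ}

lemma norm_le_of_isMin_ridgeObjective (hlam : 0 < lam) (hC : 0 ≤ C) {n : ℕ} {z : Fin n → X × Y}
    (hz : ∀ k, ‖(z k).2‖ ≤ C) {f : H}
    (hf : ∀ g, ridgeObjective ev lam z f ≤ ridgeObjective ev lam z g) :
    ‖f‖ ≤ C / Real.sqrt lam := by
  have h0 : ridgeObjective ev lam z 0 ≤ C ^ 2 := by
    have hsum : ∑ k, ‖(z k).2‖ ^ 2 ≤ n * C ^ 2 := by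
      calc ∑ k, ‖(z k).2‖ ^ 2 ≤ ∑ _k : Fin n, C ^ 2 :=
            Finset.sum_le_sum fun k _ => pow_le_pow_left₀ (norm_nonneg _) (hz k) 2
        _ = n * C ^ 2 := by simp
    have h1 := mul_le_mul_of_nonneg_left hsum (by positivity : (0 : ℝ) ≤ 1 / n)
    have h2 : 1 / (n : ℝ) * (n * C ^ 2) ≤ C ^ 2 := by
      rw [← mul_assoc, one_div]
      exact mul_le_of_le_one_left (sq_nonneg C) inv_mul_le_one
    simp only [ridgeObjective, map_zero, sub_zero, norm_zero]
    linarith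
  have h1 : lam * ‖f‖ ^ 2 ≤ ridgeObjective ev lam z f :=
    le_add_of_nonneg_left (by positivity)
  have h2 : lam * ‖f‖ ^ 2 ≤ C ^ 2 := h1.trans ((hf 0).trans h0)
  rw [le_div_iff₀ (Real.sqrt_pos.2 hlam)]
  refine le_of_sq_le_sq ?_ hC
  rw [mul_pow, Real.sq_sqrt hlam.le]
  linarith

lemma norm_residual_le (hκ : 0 ≤ κ) (hev : ∀ (x : X) (f : H), ‖ev x f‖ ≤ κ * ‖f‖) {f : H}
    (hf : ‖f‖ ≤ C / Real.sqrt lam) {p : X × Y} (hp : ‖p.2‖ ≤ C) :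
    ‖p.2 - ev p.1 f‖ ≤ C * (1 + κ / Real.sqrt lam) :=
  calc ‖p.2 - ev p.1 f‖ ≤ ‖p.2‖ + ‖ev p.1 f‖ := norm_sub_le _ _
    _ ≤ C + κ * (C / Real.sqrt lam) := by
      gcongr
      exact (hev _ _).trans (by gcongr)
    _ = C * (1 + κ / Real.sqrt lam) := by ring

lemma abs_sq_residual_sub_le (hev : ∀ (x : X) (f : H), ‖ev x f‖ ≤ κ * ‖f‖) {f g : H} {r : ℝ}
    {p : X × Y} (hf : ‖p.2 - ev p.1 f‖ ≤ r) (hg : ‖p.2 - ev p.1 g‖ ≤ r) :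
    |‖p.2 - ev p.1 f‖ ^ 2 - ‖p.2 - ev p.1 g‖ ^ 2| ≤ 2 * r * (κ * ‖f - g‖) := by
  have hdiff : |‖p.2 - ev p.1 f‖ - ‖p.2 - ev p.1 g‖| ≤ κ * ‖f - g‖ := by
    refine (abs_norm_sub_norm_le _ _).trans ?_
    have : p.2 - ev p.1 f - (p.2 - ev p.1 g) = -(ev p.1 (f - g)) := by
      rw [map_sub]; abel
    rw [this, norm_neg]
    exact hev _ _
  rw [sq_sub_sq, abs_mul, abs_of_nonneg (by positivity)]
  have h2 : ‖p.2 - ev p.1 f‖ + ‖p.2 - ev p.1 g‖ ≤ 2 * r := by linarith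
  exact mul_le_mul h2 hdiff (abs_nonneg _) ((by positivity : (0 : ℝ) ≤ _).trans h2)

/-- Stability of ridge regression: replacing one sample point moves the minimizer by `O(1/n)`. -/
lemma norm_sub_le_of_isMin_ridgeObjective_update (hlam : 0 < lam)
    (hev : ∀ (x : X) (f : H), ‖ev x f‖ ≤ κ * ‖f‖) {n : ℕ} (hn : 0 < n) {z : Fin n → X × Y}
    {i : Fin n} {w : X × Y} {f g : H}
    (hf : ∀ h, ridgeObjective ev lam z f ≤ ridgeObjective ev lam z h)
    (hg : ∀ h, ridgeObjective ev lam (Function.update z i w) g ≤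
      ridgeObjective ev lam (Function.update z i w) h) {r : ℝ} (hκr : 0 ≤ κ * r)
    (hfz : ‖(z i).2 - ev (z i).1 f‖ ≤ r) (hgz : ‖(z i).2 - ev (z i).1 g‖ ≤ r)
    (hfw : ‖w.2 - ev w.1 f‖ ≤ r) (hgw : ‖w.2 - ev w.1 g‖ ≤ r) :
    ‖f - g‖ ≤ 2 * κ * r / (lam * n) := by
  have hnR : (0 : ℝ) < n := by exact_mod_cast hn
  have hupd : ∀ h, ridgeObjective ev lam (Function.update z i w) h =
      ridgeObjective ev lam z h +
        1 / n * (‖w.2 - ev w.1 h‖ ^ 2 - ‖(z i).2 - ev (z i).1 h‖ ^ 2) := fun h => by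
    have hrest : ∑ k ∈ Finset.univ.erase i, ‖(Function.update z i w k).2 -
        ev (Function.update z i w k).1 h‖ ^ 2 =
        ∑ k ∈ Finset.univ.erase i, ‖(z k).2 - ev (z k).1 h‖ ^ 2 :=
      Finset.sum_congr rfl fun k hk => by
        rw [Function.update_of_ne (Finset.ne_of_mem_erase hk)]
    unfold ridgeObjective
    rw [← Finset.add_sum_erase _ _ (Finset.mem_univ i), hrest, Function.update_self,
      ← Finset.add_sum_erase Finset.univ (fun k => ‖(z k).2 - ev (z k).1 h‖ ^ 2)
        (Finset.mem_univ i)]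
    ring
  have h1 := mul_norm_sub_sq_le_ridgeObjective_sub ev hf g
  have h2 := mul_norm_sub_sq_le_ridgeObjective_sub ev hg f
  rw [hupd, hupd] at h2
  rw [norm_sub_rev g f] at h1
  have h3 := (abs_le.1 (abs_sq_residual_sub_le hev hfz hgz)).1
  have h4 := (abs_le.1 (abs_sq_residual_sub_le hev hfw hgw)).2
  have h5 : 2 * (lam * ‖f - g‖ ^ 2) ≤ 1 / n * (4 * r * (κ * ‖f - g‖)) := by
    have : 2 * (lam * ‖f - g‖ ^ 2) ≤ 1 / n * ((‖w.2 - ev w.1 f‖ ^ 2 - ‖w.2 - ev w.1 g‖ ^ 2) -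
        (‖(z i).2 - ev (z i).1 f‖ ^ 2 - ‖(z i).2 - ev (z i).1 g‖ ^ 2)) := by linarith
    refine this.trans ?_
    gcongr
    linarith
  rw [le_div_iff₀ (by positivity)]
  rcases (norm_nonneg (f - g)).eq_or_lt with h0 | h0
  · rw [← h0, zero_mul]
    linarith
  · refine le_of_mul_le_mul_left ?_ h0
    rw [one_div_mul_eq_div, le_div_iff₀ hnR] at h5
    linarith

end Ridge

/-- Generalization bound for functional-response ridge regression: with probability at
least `1 − δ` over an i.i.d. sample of size `m`, the expected squared loss of the
regularized least squares minimizer is bounded by its empirical risk plus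
`(1/m)·4C_y²κ²(1+κ/√λ)²/λ + (1/√m)·C_y²(1+κ/√λ)²(8κ²/λ+1)·√(ln(1/δ)/2)`. -/
theorem stmt9 {X : Type*} [MeasurableSpace X]
    {Y : Type*} [NormedAddCommGroup Y] [InnerProductSpace ℝ Y]
    [MeasurableSpace Y] [BorelSpace Y] [SecondCountableTopology Y] [CompleteSpace Y]
    {H : Type*} [NormedAddCommGroup H] [InnerProductSpace ℝ H]
    [MeasurableSpace H] [BorelSpace H] [SecondCountableTopology H] [CompleteSpace H]
    (P : Measure (X × Y)) [IsProbabilityMeasure P]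
    (ev : X → (H →L[ℝ] Y)) (κ lam Cy : ℝ) (hκ : 0 < κ) (hlam : 0 < lam) (hCy : 0 < Cy)
    (hev : ∀ (x : X) (f : H), ‖ev x f‖ ≤ κ * ‖f‖)
    (hae : ∀ᵐ p ∂P, ‖p.2‖ ≤ Cy)
    (F : (n : ℕ) → (Fin n → X × Y) → H)
    (hmin : ∀ (n : ℕ) (z : Fin n → X × Y), (∀ k, ‖(z k).2‖ ≤ Cy) →
      (∀ g : H,
        (1 / (n : ℝ)) * ∑ k, ‖(z k).2 - ev (z k).1 (F n z)‖ ^ 2 + lam * ‖F n z‖ ^ 2 ≤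
        (1 / (n : ℝ)) * ∑ k, ‖(z k).2 - ev (z k).1 g‖ ^ 2 + lam * ‖g‖ ^ 2) ∧
      (∀ f : H,
        (∀ g : H,
          (1 / (n : ℝ)) * ∑ k, ‖(z k).2 - ev (z k).1 f‖ ^ 2 + lam * ‖f‖ ^ 2 ≤
          (1 / (n : ℝ)) * ∑ k, ‖(z k).2 - ev (z k).1 g‖ ^ 2 + lam * ‖g‖ ^ 2) →
        f = F n z))
    (hFmeas : ∀ n : ℕ, Measurable (F n))
    (hLmeas : ∀ n : ℕ, Measurable (fun p : (X × Y) × (Fin n → X × Y) =>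
      ‖p.1.2 - ev p.1.1 (F n p.2)‖ ^ 2))
    (m : ℕ) (hm : 1 ≤ m) (δ : ℝ) (hδ0 : 0 < δ) (hδ1 : δ ≤ 1) :
    ENNReal.ofReal (1 - δ) ≤
      (Measure.pi fun _ : Fin m => P)
        {z | ∫ p, ‖p.2 - ev p.1 (F m z)‖ ^ 2 ∂P ≤
          (1 / (m : ℝ)) * ∑ k, ‖(z k).2 - ev (z k).1 (F m z)‖ ^ 2 +
          (1 / (m : ℝ)) * (4 * Cy ^ 2 * κ ^ 2 * (1 + κ / Real.sqrt lam) ^ 2 / lam) +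
          (1 / Real.sqrt m) *
            (Cy ^ 2 * (1 + κ / Real.sqrt lam) ^ 2 * (8 * κ ^ 2 / lam + 1)) *
            Real.sqrt (Real.log (1 / δ) / 2)} := by
  set τ : X × Y → X × Y := fun p => if ‖p.2‖ ≤ Cy then p else (p.1, 0) with hτdef
  have hτ : Measurable τ := Measurable.ite (measurableSet_le measurable_snd.norm measurable_const)
    measurable_id (measurable_fst.prodMk measurable_const)
  have hτC : ∀ p, ‖(τ p).2‖ ≤ Cy := fun p => by
    by_cases h : ‖p.2‖ ≤ Cy
    · simp [hτdef, h]
    · simp [hτdef, h, hCy.le]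
  have hτae : ∀ᵐ p ∂P, τ p = p := hae.mono fun p hp => if_pos hp
  have hmR : (0 : ℝ) < m := by exact_mod_cast hm
  have hsq : 0 < Real.sqrt lam := Real.sqrt_pos.2 hlam
  set r := Cy * (1 + κ / Real.sqrt lam) with hr
  have hr0 : 0 < r := by positivity
  have hFmin : ∀ z : Fin m → X × Y, (∀ k, ‖(z k).2‖ ≤ Cy) →
      ∀ g, ridgeObjective ev lam z (F m z) ≤ ridgeObjective ev lam z g :=
    fun z hz => (hmin m z hz).1
  have hres : ∀ (p : X × Y) (z : Fin m → X × Y), ‖p.2‖ ≤ Cy → (∀ k, ‖(z k).2‖ ≤ Cy) →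
      ‖p.2 - ev p.1 (F m z)‖ ≤ r := fun p z hp hz =>
    norm_residual_le hκ.le hev (norm_le_of_isMin_ridgeObjective hlam hCy.le hz (hFmin z hz)) hp
  set L : (X × Y) × (Fin m → X × Y) → ℝ :=
    fun q => ‖(τ q.1).2 - ev (τ q.1).1 (F m (τ ∘ q.2))‖ ^ 2 with hLdef
  have hL : Measurable L := by
    have hcomp : Measurable fun z : Fin m → X × Y => τ ∘ z :=
      measurable_pi_lambda _ fun k => hτ.comp (measurable_pi_apply k)
    exact (hLmeas m).comp ((hτ.comp measurable_fst).prodMk (hcomp.comp measurable_snd))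
  have hstab : ∀ p z i w, |L (p, z) - L (p, Function.update z i w)| ≤
      4 * κ ^ 2 * r ^ 2 / (lam * m) := by
    intro p z i w
    have hz : ∀ k, ‖((τ ∘ z) k).2‖ ≤ Cy := fun k => hτC _
    have hz' : ∀ k, ‖(Function.update (τ ∘ z) i (τ w) k).2‖ ≤ Cy := fun k => by
      rw [← Function.comp_update]
      exact hτC _
    have hd := norm_sub_le_of_isMin_ridgeObjective_update hlam hev hm (hFmin _ hz) (hFmin _ hz')
      (by positivity) (hres _ _ (hz i) hz) (hres _ _ (hz i) hz') (hres _ _ (hτC w) hz)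
      (hres _ _ (hτC w) hz')
    simp only [hLdef, Function.comp_update]
    refine (abs_sq_residual_sub_le hev (hres _ _ (hτC p) hz) (hres _ _ (hτC p) hz')).trans ?_
    calc _ ≤ 2 * r * (κ * (2 * κ * r / (lam * m))) := by gcongr
      _ = 4 * κ ^ 2 * r ^ 2 / (lam * m) := by ring
  refine (one_sub_le_measure_of_uniform_stability P hm hL (M := r ^ 2)
    (b := 4 * κ ^ 2 * r ^ 2 / (lam * m)) (by positivity) (by positivity)
    (fun q => sq_nonneg _)
    (fun q => pow_le_pow_left₀ (norm_nonneg _) (hres _ _ (hτC q.1) fun k => hτC _) 2)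
    hstab hδ0 hδ1).trans (measure_mono_ae ?_)
  have hzae : ∀ᵐ z ∂(Measure.pi fun _ : Fin m => P), ∀ k, τ (z k) = z k :=
    ae_all_iff.2 fun k =>
      (Measure.tendsto_eval_ae_ae (μ := fun _ : Fin m => P) (i := k)).eventually hτae
  filter_upwards [hzae] with z hz hbound
  have hτz : τ ∘ z = z := funext hz
  have hint : ∫ p, L (p, z) ∂P = ∫ p, ‖p.2 - ev p.1 (F m z)‖ ^ 2 ∂P :=
    integral_congr_ae (hτae.mono fun p hp => by simp only [hLdef, hτz, hp])
  have hsum : ∑ k, L (z k, z) = ∑ k, ‖(z k).2 - ev (z k).1 (F m z)‖ ^ 2 :=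
    Finset.sum_congr rfl fun k _ => by simp only [hLdef, hτz, hz k]
  change _ ≤ _ at hbound
  rw [hint, hsum] at hbound
  change _ ≤ _
  refine hbound.trans (le_of_eq ?_)
  have hsm : Real.sqrt m ≠ 0 := (Real.sqrt_pos.2 hmR).ne'
  have hconst : (2 * (4 * κ ^ 2 * r ^ 2 / (lam * m)) + r ^ 2 / m) * Real.sqrt m =
      1 / Real.sqrt m * (r ^ 2 * (8 * κ ^ 2 / lam + 1)) := by
    have hmm : (m : ℝ) = Real.sqrt m * Real.sqrt m := (Real.mul_self_sqrt hmR.le).symm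
    generalize Real.sqrt m = s at hmm hsm ⊢
    rw [hmm]
    field_simp
    ring
  rw [hconst, ← mul_pow, ← hr]
  congr 2
  rw [hr]
  ring
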